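/- Let N, M, C be positive natural numbers and τ > 0. For a tensor A ∈ ℝ^{N×M×C}, define for each index i the vector v^{(i)} ∈ ℝ^M as the Euclidean projection of the vector ( (1/τ)‖A_{i,j,:}‖₂ )_{j=1}^M onto the closed unit ℓ¹ ball {w ∈ ℝ^M : Σ_j |w_j| ≤ 1}. Then the tensor Â defined by Â_{i,j,k} := (A_{i,j,k}/‖A_{i,j,:}‖₂) · max(‖A_{i,j,:}‖₂ − τ v^{(i)}_j, 0) when ‖A_{i,j,:}‖₂ ≠ 0, and Â_{i,j,k} := 0 when ‖A_{i,j,:}‖₂ = 0, is a minimizer over Y ∈ ℝ^{N×M×C} of ½‖Y − A‖₂² + τ ‖Y‖_{2,∞,1}, where ‖Y‖_{2,∞,1} := Σ_i max_j ‖Y_{i,j,:}‖₂ and ‖Y_{i,j,:}‖₂ := sqrt(Σ_k Y_{i,j,k}²). -/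

import Mathlib

/-- Euclidean norm of the fiber `Y_{i,j,:}` of a tensor. -/
noncomputable def fiberNorm {N M C : ℕ} (Y : Fin N → Fin M → Fin C → ℝ)
    (i : Fin N) (j : Fin M) : ℝ :=
  Real.sqrt (∑ k, (Y i j k) ^ 2)

/-- The objective `½‖Y − A‖₂² + τ‖Y‖_{2,∞,1}`, where
`‖Y‖_{2,∞,1} = Σ_i max_j ‖Y_{i,j,:}‖₂`. -/
noncomputable def objL2inf1 {N M C : ℕ} (τ : ℝ) (A Y : Fin N → Fin M → Fin C → ℝ) : ℝ :=
  (1/2) * ∑ i, ∑ j, ∑ k, (Y i j k - A i j k) ^ 2 + τ * ∑ i, ⨆ j, fiberNorm Y i j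

lemma proj_vi {M : ℕ} (v b w : Fin M → ℝ) (hv : ∑ j, |v j| ≤ 1)
    (hmin : ∀ w : Fin M → ℝ, ∑ j, |w j| ≤ 1 →
        ∑ j, (v j - b j) ^ 2 ≤ ∑ j, (w j - b j) ^ 2)
    (hw : ∑ j, |w j| ≤ 1) : ∑ j, (w j - v j) * (b j - v j) ≤ 0 := by
  set P := ∑ j, (w j - v j) * (b j - v j) with hP
  set Q := ∑ j, (w j - v j) ^ 2 with hQ
  have hQ0 : 0 ≤ Q := Finset.sum_nonneg fun j _ => sq_nonneg _
  have key : ∀ s : ℝ, 0 ≤ s → s ≤ 1 → 0 ≤ s * (s * Q - 2 * P) := by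
    intro s h0 h1
    have h := hmin (fun j => (1 - s) * v j + s * w j) (by
      calc ∑ j, |(1 - s) * v j + s * w j| ≤ ∑ j, ((1 - s) * |v j| + s * |w j|) := by
            refine Finset.sum_le_sum fun j _ => (abs_add_le _ _).trans ?_
            rw [abs_mul, abs_mul, abs_of_nonneg h0, abs_of_nonneg (sub_nonneg.2 h1)]
        _ = (1 - s) * ∑ j, |v j| + s * ∑ j, |w j| := by
            rw [Finset.sum_add_distrib, Finset.mul_sum, Finset.mul_sum]
        _ ≤ 1 := by nlinarith)
    have e : ∑ j, ((1 - s) * v j + s * w j - b j) ^ 2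
        = ∑ j, (v j - b j) ^ 2 + s * (s * Q - 2 * P) := by
      rw [hP, hQ, mul_sub, ← mul_assoc, ← mul_assoc, Finset.mul_sum, Finset.mul_sum,
        ← Finset.sum_sub_distrib, ← Finset.sum_add_distrib]
      exact Finset.sum_congr rfl fun j _ => by ring
    linarith
  by_contra! hc
  have hpos : 0 < Q + P := by linarith
  have h1 := key (P / (Q + P)) (by positivity) (by rw [div_le_one hpos]; linarith)
  have h2 : P / (Q + P) * Q - 2 * P < 0 := by
    have : P / (Q + P) * Q ≤ P := by
      rw [div_mul_eq_mul_div, div_le_iff₀ hpos]; nlinarith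
    linarith
  have h3 : 0 < P / (Q + P) := by positivity
  nlinarith

lemma proj_facts {M : ℕ} (v b : Fin M → ℝ) (hb : ∀ j, 0 ≤ b j) (hv : ∑ j, |v j| ≤ 1)
    (hmin : ∀ w : Fin M → ℝ, ∑ j, |w j| ≤ 1 →
        ∑ j, (v j - b j) ^ 2 ≤ ∑ j, (w j - b j) ^ 2) :
    (∀ j, 0 ≤ v j ∧ v j ≤ b j) ∧ ∀ j, b j - v j ≤ ∑ l, v l * (b l - v l) := by
  constructor
  · have hw : ∑ j, |max 0 (min (v j) (b j))| ≤ 1 := by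
      refine (Finset.sum_le_sum fun j _ => ?_).trans hv
      rw [abs_of_nonneg (le_max_left _ _)]
      exact max_le (abs_nonneg _) ((min_le_left _ _).trans (le_abs_self _))
    have h := proj_vi v b _ hv hmin hw
    have hn : ∀ j ∈ Finset.univ, 0 ≤ (max 0 (min (v j) (b j)) - v j) * (b j - v j) := by
      intro j _
      have := hb j
      rcases le_total (v j) (b j) with h | h
      · rw [min_eq_left h]
        exact mul_nonneg (sub_nonneg.2 (le_max_right _ _)) (sub_nonneg.2 h)
      · rw [min_eq_right h, max_eq_right this]
        exact mul_self_nonneg _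
    have h0 := (Finset.sum_eq_zero_iff_of_nonneg hn).1 (le_antisymm h (Finset.sum_nonneg hn))
    intro j
    have hj := h0 j (Finset.mem_univ _)
    have := hb j
    rcases mul_eq_zero.1 hj with h | h
    · have h : max 0 (min (v j) (b j)) = v j := sub_eq_zero.1 h
      refine ⟨h ▸ le_max_left _ _, ?_⟩
      rw [← h]
      exact max_le this (min_le_right _ _)
    · constructor <;> linarith
  · intro j
    have h := proj_vi v b (fun l => if l = j then 1 else 0) hv hmin (by
      simp [apply_ite])
    simp only [sub_mul, Finset.sum_sub_distrib, ite_mul, one_mul, zero_mul,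
      Finset.sum_ite_eq', Finset.mem_univ, if_true] at h
    have := h
    simpa [sub_nonpos] using h

lemma fiber_sq {N M C : ℕ} (Y : Fin N → Fin M → Fin C → ℝ) (i : Fin N) (j : Fin M) :
    fiberNorm Y i j ^ 2 = ∑ k, (Y i j k) ^ 2 :=
  Real.sq_sqrt (Finset.sum_nonneg fun k _ => sq_nonneg _)

lemma fiber_nonneg {N M C : ℕ} (Y : Fin N → Fin M → Fin C → ℝ) (i : Fin N) (j : Fin M) :
    0 ≤ fiberNorm Y i j := Real.sqrt_nonneg _

lemma fiber_dist {N M C : ℕ} (A Y : Fin N → Fin M → Fin C → ℝ) (i : Fin N) (j : Fin M) :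
    (fiberNorm Y i j - fiberNorm A i j) ^ 2 ≤ ∑ k, (Y i j k - A i j k) ^ 2 := by
  have h := Real.sum_mul_le_sqrt_mul_sqrt Finset.univ (fun k => Y i j k) (fun k => A i j k)
  have e : ∑ k, (Y i j k - A i j k) ^ 2 = fiberNorm Y i j ^ 2 + fiberNorm A i j ^ 2
      - 2 * ∑ k, Y i j k * A i j k := by
    rw [fiber_sq, fiber_sq, Finset.mul_sum, ← Finset.sum_add_distrib, ← Finset.sum_sub_distrib]
    exact Finset.sum_congr rfl fun k _ => by ring
  change _ ≤ fiberNorm Y i j * fiberNorm A i j at h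
  rw [e]
  linarith [sub_sq (fiberNorm Y i j) (fiberNorm A i j)]

/-- The proximity operator of the `ℓ^{2,∞,1}` norm: shrink each fiber `A_{i,j,:}` by
`τ v^{(i)}_j`, where `v^{(i)}` is the Euclidean projection of the vector of scaled
fiber norms `(1/τ)‖A_{i,j,:}‖₂` onto the unit `ℓ¹` ball of `ℝ^M`. -/
theorem prox_l2inf1 (N M C : ℕ) (hN : 0 < N) (hM : 0 < M) (hC : 0 < C)
    (τ : ℝ) (hτ : 0 < τ)
    (A : Fin N → Fin M → Fin C → ℝ)
    (v : Fin N → Fin M → ℝ)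
    (hv_mem : ∀ i, ∑ j, |v i j| ≤ 1)
    (hv_min : ∀ (i : Fin N) (w : Fin M → ℝ), ∑ j, |w j| ≤ 1 →
        ∑ j, (v i j - (1/τ) * fiberNorm A i j) ^ 2
          ≤ ∑ j, (w j - (1/τ) * fiberNorm A i j) ^ 2)
    (Ahat : Fin N → Fin M → Fin C → ℝ)
    (hAhat : ∀ i j k, Ahat i j k =
        if fiberNorm A i j = 0 then 0
        else (A i j k / fiberNorm A i j) * max (fiberNorm A i j - τ * v i j) 0) :
    ∀ Y : Fin N → Fin M → Fin C → ℝ, objL2inf1 τ A Ahat ≤ objL2inf1 τ A Y := by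
  intro Y
  haveI : Nonempty (Fin M) := ⟨⟨0, hM⟩⟩
  unfold objL2inf1
  rw [Finset.mul_sum, Finset.mul_sum, Finset.mul_sum, Finset.mul_sum,
    ← Finset.sum_add_distrib, ← Finset.sum_add_distrib]
  refine Finset.sum_le_sum fun i _ => ?_
  obtain ⟨hf, hs⟩ := proj_facts (v i) (fun j => 1 / τ * fiberNorm A i j)
    (fun j => mul_nonneg (by positivity) (fiber_nonneg A i j)) (hv_mem i) (hv_min i)
  have hr : ∀ j, fiberNorm A i j - τ * v i j = τ * (1 / τ * fiberNorm A i j - v i j) := by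
    intro j; field_simp
  have hr0 : ∀ j, 0 ≤ fiberNorm A i j - τ * v i j := fun j => by
    rw [hr]; exact mul_nonneg hτ.le (sub_nonneg.2 (hf j).2)
  have hA0 : ∀ j, fiberNorm A i j = 0 → v i j = 0 := fun j h => by
    have := hf j
    simp only [h, mul_zero] at this
    linarith [this.1, this.2]
  have hAk : ∀ j k, fiberNorm A i j = 0 → A i j k = 0 := fun j k h => by
    have h2 := fiber_sq A i j
    rw [h, zero_pow two_ne_zero] at h2
    have := (Finset.sum_eq_zero_iff_of_nonneg (fun k _ => sq_nonneg (A i j k))).1 h2.symm k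
      (Finset.mem_univ _)
    exact pow_eq_zero_iff two_ne_zero |>.1 this
  have hn : ∀ j, fiberNorm Ahat i j = fiberNorm A i j - τ * v i j := by
    intro j
    have hsq : fiberNorm Ahat i j ^ 2 = (fiberNorm A i j - τ * v i j) ^ 2 := by
      rw [fiber_sq]
      by_cases h : fiberNorm A i j = 0
      · simp [hAhat, h, hA0 j h]
      · simp only [hAhat, h, if_false, max_eq_left (hr0 j), mul_pow, div_pow]
        rw [← Finset.sum_mul, ← Finset.sum_div, ← fiber_sq, div_self (pow_ne_zero 2 h), one_mul]
    exact (pow_left_inj₀ (fiber_nonneg _ _ _) (hr0 j) two_ne_zero).1 hsq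
  have hd : ∀ j, ∑ k, (Ahat i j k - A i j k) ^ 2 = (τ * v i j) ^ 2 := by
    intro j
    by_cases h : fiberNorm A i j = 0
    · simp [hAhat, h, hA0 j h, hAk j _ h]
    · have : ∀ k, (Ahat i j k - A i j k) ^ 2
          = (A i j k) ^ 2 / fiberNorm A i j ^ 2 * (τ * v i j) ^ 2 := by
        intro k
        rw [hAhat, if_neg h, max_eq_left (hr0 j)]
        field_simp
        ring
      simp only [this]
      rw [← Finset.sum_mul, ← Finset.sum_div, ← fiber_sq, div_self (pow_ne_zero 2 h), one_mul]
  have h1 : ⨆ j, fiberNorm Ahat i j ≤ ∑ l, v i l * (fiberNorm A i l - τ * v i l) := by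
    refine ciSup_le fun j => ?_
    rw [hn, hr]
    refine (mul_le_mul_of_nonneg_left (hs j) hτ.le).trans (le_of_eq ?_)
    rw [Finset.mul_sum]
    exact Finset.sum_congr rfl fun l _ => by rw [hr]; ring
  have h2 : ∑ l, v i l * fiberNorm Y i l ≤ ⨆ j, fiberNorm Y i j := by
    have hle : ∀ j, fiberNorm Y i j ≤ ⨆ j, fiberNorm Y i j :=
      fun j => le_ciSup (Set.finite_range _).bddAbove j
    have hS : 0 ≤ ⨆ j, fiberNorm Y i j := (fiber_nonneg Y i ⟨0, hM⟩).trans (hle _)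
    have hsum : ∑ l, v i l ≤ 1 :=
      (Finset.sum_le_sum fun l _ => le_abs_self _).trans (hv_mem i)
    calc ∑ l, v i l * fiberNorm Y i l ≤ ∑ l, v i l * ⨆ j, fiberNorm Y i j :=
          Finset.sum_le_sum fun l _ => mul_le_mul_of_nonneg_left (hle l) (hf l).1
      _ = (∑ l, v i l) * ⨆ j, fiberNorm Y i j := by rw [Finset.sum_mul]
      _ ≤ _ := by nlinarith
  have h3 : 1 / 2 * ∑ j, ∑ k, (Ahat i j k - A i j k) ^ 2
        + τ * ∑ l, v i l * (fiberNorm A i l - τ * v i l)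
      ≤ 1 / 2 * ∑ j, ∑ k, (Y i j k - A i j k) ^ 2 + τ * ∑ l, v i l * fiberNorm Y i l := by
    simp only [Finset.mul_sum (s := (Finset.univ : Finset (Fin M)))]
    rw [← Finset.sum_add_distrib, ← Finset.sum_add_distrib]
    refine Finset.sum_le_sum fun j _ => ?_
    rw [hd]
    have := fiber_dist A Y i j
    nlinarith [sq_nonneg (fiberNorm Y i j - (fiberNorm A i j - τ * v i j))]
  have h4 := mul_le_mul_of_nonneg_left h1 hτ.le
  have h5 := mul_le_mul_of_nonneg_left h2 hτ.le
  linarith
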